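/- Let Σ be a finite alphabet and φ : Σ* → Σ* a nonerasing morphism. If b ∈ Σ is a letter of order ∞, then φ(b) contains at least one letter of order ∞, and there exists N such that for every n ≥ N the word φ^n(b) contains at least two occurrences of letters of order ∞. -/

import Mathlib

open Asymptotics Filter

/-- Apply a morphism (given by its values on letters) to a finite word. -/
def substWord {A : Type*} (φ : A → List A) : List A → List A
  | [] => []
  | a :: w => φ a ++ substWord φ w

/-- The `n`-th iterate of a morphism applied to a word. -/
def iterWord {A : Type*} (φ : A → List A) (n : ℕ) (w : List A) : List A :=
  (substWord φ)^[n] w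

/-- The letter `b` has order `∞`: `|φ^n(b)| = Ω(q^n)` for some real `q > 1`. -/
def HasOrderInf {A : Type*} (φ : A → List A) (b : A) : Prop :=
  ∃ q : ℝ, 1 < q ∧
    (fun n => q ^ n) =O[atTop] (fun n => ((iterWord φ n [b]).length : ℝ))

section Words

variable {A : Type*} (φ : A → List A)

lemma substWord_append (u v : List A) :
    substWord φ (u ++ v) = substWord φ u ++ substWord φ v := by
  induction u with
  | nil => rfl
  | cons a u ih => simp [substWord, ih]

lemma iterWord_append (n : ℕ) (u v : List A) :
    iterWord φ n (u ++ v) = iterWord φ n u ++ iterWord φ n v := by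
  induction n generalizing u v with
  | zero => rfl
  | succ n ih =>
    simp only [iterWord, Function.iterate_succ_apply] at ih ⊢
    rw [substWord_append, ih]

lemma iterWord_cons (n : ℕ) (a : A) (w : List A) :
    iterWord φ n (a :: w) = iterWord φ n [a] ++ iterWord φ n w :=
  iterWord_append φ n [a] w

lemma iterWord_nil (n : ℕ) : iterWord φ n [] = [] := by
  induction n with
  | zero => rfl
  | succ n ih => exact ih

lemma iterWord_succ_singleton (n : ℕ) (a : A) :
    iterWord φ (n + 1) [a] = iterWord φ n (φ a) := by
  simp [iterWord, Function.iterate_succ_apply, substWord]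

lemma iterWord_add (m n : ℕ) (w : List A) :
    iterWord φ (m + n) w = iterWord φ m (iterWord φ n w) :=
  Function.iterate_add_apply _ m n w

lemma iterWord_succ_apply' (n : ℕ) (w : List A) :
    iterWord φ (n + 1) w = substWord φ (iterWord φ n w) :=
  Function.iterate_succ_apply' _ n w

/-- The lengths `|φ^n(w)|` grow more slowly than every exponential. -/
def SubexpGrowth (w : List A) : Prop :=
  ∀ q : ℝ, 1 < q → ∃ C : ℝ, ∀ n : ℕ, ((iterWord φ n w).length : ℝ) ≤ C * q ^ n

variable {φ}

lemma subexpGrowth_of_forall_mem {w : List A} (h : ∀ a ∈ w, SubexpGrowth φ [a]) :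
    SubexpGrowth φ w := by
  induction w with
  | nil => exact fun q _ => ⟨0, fun n => by simp [iterWord_nil]⟩
  | cons a w ih =>
    intro q hq
    obtain ⟨C, hC⟩ := h a (by simp) q hq
    obtain ⟨D, hD⟩ := ih (fun b hb => h b (by simp [hb])) q hq
    refine ⟨C + D, fun n => ?_⟩
    rw [iterWord_cons, List.length_append, Nat.cast_add, add_mul]
    exact add_le_add (hC n) (hD n)

lemma subexpGrowth_singleton_of_image {a : A} (h : SubexpGrowth φ (φ a)) :
    SubexpGrowth φ [a] := by
  intro q hq
  obtain ⟨C, hC⟩ := h q hq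
  have hC0 : 0 ≤ C := by
    have := (Nat.cast_nonneg _).trans (hC 0)
    simpa using this
  refine ⟨C + 1, fun n => ?_⟩
  cases n with
  | zero => simpa [iterWord] using hC0
  | succ n =>
    rw [iterWord_succ_singleton]
    have hpow : q ^ n ≤ q ^ (n + 1) := pow_le_pow_right₀ hq.le n.le_succ
    have hpos : 0 ≤ q ^ n := by positivity
    nlinarith [hC n, mul_le_mul_of_nonneg_left hpow hC0]

lemma HasOrderInf.not_subexpGrowth {a : A} (h : HasOrderInf φ a) : ¬ SubexpGrowth φ [a] := by
  intro hs
  obtain ⟨q, hq, hO⟩ := h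
  have hr : 1 < √q := Real.lt_sqrt_of_sq_lt (by simpa using hq)
  obtain ⟨C, hC⟩ := hs _ hr
  obtain ⟨D, hD, hO⟩ := hO.exists_pos
  obtain ⟨n, hn, hlarge⟩ := (hO.bound.and
    ((tendsto_pow_atTop_atTop_of_one_lt hr).eventually_gt_atTop (D * C))).exists
  have hpos : 0 < √q ^ n := by positivity
  have hsq : q ^ n = √q ^ n * √q ^ n := by
    rw [← mul_pow, Real.mul_self_sqrt (by linarith)]
  rw [Real.norm_of_nonneg (by positivity), Real.norm_of_nonneg (by positivity), hsq] at hn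
  nlinarith [mul_le_mul_of_nonneg_left (hC n) hD.le, mul_lt_mul_of_pos_right hlarge hpos]

open Classical in
variable (φ) in
/-- The number of occurrences in `w` of letters whose growth is not subexponential. -/
noncomputable def countFast (w : List A) : ℕ :=
  w.countP fun a => ¬ SubexpGrowth φ [a]

lemma countFast_append (u v : List A) :
    countFast φ (u ++ v) = countFast φ u + countFast φ v :=
  List.countP_append

lemma countFast_cons (a : A) (w : List A) :
    countFast φ (a :: w) = countFast φ [a] + countFast φ w :=
  countFast_append [a] w

lemma countFast_singleton_of_subexpGrowth {a : A} (h : SubexpGrowth φ [a]) :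
    countFast φ [a] = 0 := by
  simp [countFast, h]

lemma countFast_singleton_of_not_subexpGrowth {a : A} (h : ¬ SubexpGrowth φ [a]) :
    countFast φ [a] = 1 := by
  simp [countFast, h]

lemma countFast_eq_zero {w : List A} : countFast φ w = 0 ↔ ∀ a ∈ w, SubexpGrowth φ [a] := by
  simp [countFast, List.countP_eq_zero]

lemma countFast_le_substWord (w : List A) : countFast φ w ≤ countFast φ (substWord φ w) := by
  induction w with
  | nil => rfl
  | cons a w ih =>
    rw [countFast_cons, substWord, countFast_append]
    refine add_le_add ?_ ih
    by_cases ha : SubexpGrowth φ [a]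
    · simp [countFast_singleton_of_subexpGrowth ha]
    · rw [countFast_singleton_of_not_subexpGrowth ha, Nat.one_le_iff_ne_zero]
      exact fun h => ha (subexpGrowth_singleton_of_image
        (subexpGrowth_of_forall_mem (countFast_eq_zero.1 h)))

lemma countFast_iterWord_mono (w : List A) : Monotone fun n => countFast φ (iterWord φ n w) :=
  monotone_nat_of_le_succ fun n => by
    rw [iterWord_succ_apply']
    exact countFast_le_substWord _

lemma length_iterWord_le_of_forall_mem {n : ℕ} {K : ℝ} {w : List A}
    (h : ∀ a ∈ w, ((iterWord φ n [a]).length : ℝ) ≤ K) :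
    ((iterWord φ n w).length : ℝ) ≤ w.length * K := by
  induction w with
  | nil => simp [iterWord_nil]
  | cons a w ih =>
    rw [iterWord_cons, List.length_append, List.length_cons]
    push_cast
    linarith [h a (by simp), ih fun b hb => h b (by simp [hb])]

/-- If `φ^k(w)` never has two fast letters, then `|φ^n(w)|` is controlled by the slow letters of
`w` and at most one fast letter. -/
lemma length_iterWord_le_of_countFast_le_one {n : ℕ} {K B : ℝ} (hB : 0 ≤ B) (hK : 0 ≤ K)
    (hslow : ∀ a, SubexpGrowth φ [a] → ((iterWord φ n [a]).length : ℝ) ≤ K)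
    (hfast : ∀ a, (∀ k, countFast φ (iterWord φ k [a]) ≤ 1) →
      ((iterWord φ n [a]).length : ℝ) ≤ B)
    {w : List A} (hw : ∀ k, countFast φ (iterWord φ k w) ≤ 1) :
    ((iterWord φ n w).length : ℝ) ≤ B + w.length * K := by
  induction w with
  | nil => simpa [iterWord_nil] using hB
  | cons a w ih =>
    have hsplit (k : ℕ) : countFast φ (iterWord φ k [a]) + countFast φ (iterWord φ k w) ≤ 1 := by
      rw [← countFast_append, ← iterWord_cons]
      exact hw k
    rw [iterWord_cons, List.length_append, List.length_cons]
    push_cast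
    by_cases ha : SubexpGrowth φ [a]
    · linarith [hslow a ha, ih fun k => le_of_add_le_right (hsplit k)]
    · have h0 : countFast φ [a] + countFast φ w ≤ 1 := hsplit 0
      rw [countFast_singleton_of_not_subexpGrowth ha] at h0
      have hw0 := countFast_eq_zero.1 (show countFast φ w = 0 by omega)
      linarith [hfast a fun k => le_of_add_le_left (hsplit k),
        length_iterWord_le_of_forall_mem fun b hb => hslow b (hw0 b hb)]

lemma subexpGrowth_of_countFast_le_one [Finite A] {a : A}
    (ha : ∀ k, countFast φ (iterWord φ k [a]) ≤ 1) : SubexpGrowth φ [a] := by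
  intro q hq
  have := Fintype.ofFinite A
  have hr : 1 < √q := Real.lt_sqrt_of_sq_lt (by simpa using hq)
  set r := √q with hrdef
  have hr2 : r * r = q := Real.mul_self_sqrt (by linarith)
  have hslow : ∃ C : ℝ, 0 ≤ C ∧ ∀ n c, SubexpGrowth φ [c] →
      ((iterWord φ n [c]).length : ℝ) ≤ C * r ^ n := by
    have hex (c : A) : ∃ C : ℝ, SubexpGrowth φ [c] →
        ∀ n, ((iterWord φ n [c]).length : ℝ) ≤ C * r ^ n := by
      by_cases hc : SubexpGrowth φ [c]
      · obtain ⟨C, hC⟩ := hc r hr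
        exact ⟨C, fun _ => hC⟩
      · exact ⟨0, fun h => absurd h hc⟩
    choose C hC using hex
    refine ⟨∑ c, |C c|, by positivity, fun n c hc => (hC c hc n).trans ?_⟩
    gcongr
    exact (le_abs_self _).trans
      (Finset.single_le_sum (f := fun c => |C c|) (fun _ _ => abs_nonneg _) (Finset.mem_univ c))
  obtain ⟨C, hC0, hC⟩ := hslow
  obtain ⟨M, hM⟩ : ∃ M : ℕ, ∀ c, (φ c).length ≤ M :=
    ⟨∑ c, (φ c).length, fun c => Finset.single_le_sum (f := fun c => (φ c).length)
      (fun _ _ => Nat.zero_le _) (Finset.mem_univ c)⟩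
  have key (n : ℕ) : ∀ c, (∀ k, countFast φ (iterWord φ k [c]) ≤ 1) →
      ((iterWord φ n [c]).length : ℝ) ≤ 1 + n * (M * C * r ^ n) := by
    induction n with
    | zero => intro c _; simp [iterWord]
    | succ n ih =>
      intro c hc
      rw [iterWord_succ_singleton]
      have hlen := length_iterWord_le_of_countFast_le_one (w := φ c) (by positivity)
        (by positivity) (hC n) ih fun k => by simpa [iterWord_succ_singleton] using hc (k + 1)
      have hM' : ((φ c).length : ℝ) * (C * r ^ n) ≤ M * (C * r ^ n) := by
        gcongr
        exact hM c
      have hpow : (n + 1 : ℝ) * (M * C * r ^ n) ≤ (n + 1) * (M * C * r ^ (n + 1)) := by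
        gcongr
        · exact hr.le
        · exact n.le_succ
      push_cast
      linarith
  refine ⟨1 + M * C / (r - 1), fun n => (key n a ha).trans ?_⟩
  have hr1 : 0 < r - 1 := by linarith
  have hbern : n ≤ r ^ n / (r - 1) := by
    rw [le_div_iff₀ hr1]
    have := one_add_mul_le_pow (a := r - 1) (by linarith) n
    rw [add_sub_cancel] at this
    linarith
  have hqn : q ^ n = r ^ n * r ^ n := by rw [← hr2, mul_pow]
  have hone : 1 ≤ q ^ n := one_le_pow₀ hq.le
  calc 1 + n * (M * C * r ^ n) ≤ q ^ n + r ^ n / (r - 1) * (M * C * r ^ n) := by gcongr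
    _ = (1 + M * C / (r - 1)) * q ^ n := by rw [hqn]; ring

lemma exists_two_le_countFast [Finite A] {a : A} (ha : ¬ SubexpGrowth φ [a]) :
    ∃ k, 2 ≤ countFast φ (iterWord φ k [a]) := by
  by_contra! h
  exact ha (subexpGrowth_of_countFast_le_one fun k => Nat.le_of_lt_succ (h k))

lemma exists_two_mul_countFast_le [Finite A] :
    ∃ m, 0 < m ∧ ∀ w, 2 * countFast φ w ≤ countFast φ (iterWord φ m w) := by
  have := Fintype.ofFinite A
  have hex (a : A) : ∃ k, 2 * countFast φ [a] ≤ countFast φ (iterWord φ k [a]) := by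
    by_cases ha : SubexpGrowth φ [a]
    · exact ⟨0, by simp [countFast_singleton_of_subexpGrowth ha]⟩
    · simpa [countFast_singleton_of_not_subexpGrowth ha] using exists_two_le_countFast ha
  choose k hk using hex
  refine ⟨∑ a, k a + 1, Nat.succ_pos _, fun w => ?_⟩
  induction w with
  | nil => simp [countFast]
  | cons a w ih =>
    rw [countFast_cons, iterWord_cons, countFast_append, mul_add]
    have hka : k a ≤ ∑ a, k a + 1 :=
      (Finset.single_le_sum (fun _ _ => Nat.zero_le _) (Finset.mem_univ a)).trans (Nat.le_succ _)
    exact add_le_add ((hk a).trans (countFast_iterWord_mono [a] hka)) ih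

lemma hasOrderInf_of_not_subexpGrowth [Finite A] {a : A} (ha : ¬ SubexpGrowth φ [a]) :
    HasOrderInf φ a := by
  obtain ⟨m, hm, hdouble⟩ := exists_two_mul_countFast_le (φ := φ)
  have hpow (j : ℕ) : 2 ^ j ≤ countFast φ (iterWord φ (m * j) [a]) := by
    induction j with
    | zero => exact (countFast_singleton_of_not_subexpGrowth ha).ge
    | succ j ih =>
      rw [mul_add, mul_one, add_comm (m * j), iterWord_add, pow_succ']
      exact (Nat.mul_le_mul_left 2 ih).trans (hdouble _)
  have hq : (1 : ℝ) < 2 ^ (1 / m : ℝ) := Real.one_lt_rpow (by norm_num) (by positivity)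
  have hqm : ((2 : ℝ) ^ (1 / m : ℝ)) ^ m = 2 := by
    rw [one_div]
    exact Real.rpow_inv_natCast_pow (by norm_num) hm.ne'
  refine ⟨2 ^ (1 / m : ℝ), hq, IsBigO.of_bound 2 (Eventually.of_forall fun n => ?_)⟩
  rw [Real.norm_of_nonneg (by positivity), Real.norm_of_nonneg (by positivity)]
  have hlen : 2 ^ (n / m) ≤ (iterWord φ n [a]).length :=
    (hpow _).trans ((countFast_iterWord_mono [a] (Nat.mul_div_le n m)).trans List.countP_le_length)
  calc ((2 : ℝ) ^ (1 / m : ℝ)) ^ n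
      ≤ ((2 : ℝ) ^ (1 / m : ℝ)) ^ (m * (n / m + 1)) :=
        pow_le_pow_right₀ hq.le (Nat.lt_mul_div_succ n hm).le
    _ = 2 * 2 ^ (n / m) := by rw [pow_mul, hqm, pow_succ']
    _ ≤ 2 * (iterWord φ n [a]).length := by
        gcongr
        exact_mod_cast hlen

lemma exists_ne_get_of_two_le_countFast {w : List A} (h : 2 ≤ countFast φ w) :
    ∃ i j : Fin w.length, i ≠ j ∧
      ¬ SubexpGrowth φ [w.get i] ∧ ¬ SubexpGrowth φ [w.get j] := by
  classical
  rw [countFast, List.countP_eq_length_filter] at h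
  obtain ⟨f, hf⟩ := List.sublist_iff_exists_fin_orderEmbedding_get_eq.1
    (List.filter_sublist (l := w) (p := fun a => ¬ SubexpGrowth φ [a]))
  have hmem (i) : ¬ SubexpGrowth φ [w.get (f i)] := by
    rw [← hf i]
    simpa using (List.mem_filter.1 (List.get_mem _ i)).2
  exact ⟨f ⟨0, by omega⟩, f ⟨1, by omega⟩, by simp, hmem _, hmem _⟩

end Words

/-- If `b` has order `∞`, then `φ(b)` contains a letter of order `∞`, and for
all sufficiently large `n` the word `φ^n(b)` contains at least two occurrences
of letters of order `∞`. -/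
theorem stmt7 {A : Type*} [Fintype A] (φ : A → List A)
    (hφ : ∀ b : A, φ b ≠ []) (b : A) (hb : HasOrderInf φ b) :
    (∃ c ∈ φ b, HasOrderInf φ c) ∧
    ∃ N : ℕ, ∀ n : ℕ, N ≤ n →
      ∃ i j : Fin (iterWord φ n [b]).length, i ≠ j ∧
        HasOrderInf φ ((iterWord φ n [b]).get i) ∧
        HasOrderInf φ ((iterWord φ n [b]).get j) := by
  have hfast := hb.not_subexpGrowth
  constructor
  · by_contra! h
    exact hfast (subexpGrowth_singleton_of_image (subexpGrowth_of_forall_mem fun c hc =>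
      not_not.1 fun hc' => h c hc (hasOrderInf_of_not_subexpGrowth hc')))
  · obtain ⟨N, hN⟩ := exists_two_le_countFast hfast
    refine ⟨N, fun n hn => ?_⟩
    obtain ⟨i, j, hij, hi, hj⟩ :=
      exists_ne_get_of_two_le_countFast (hN.trans (countFast_iterWord_mono [b] hn))
    exact ⟨i, j, hij, hasOrderInf_of_not_subexpGrowth hi, hasOrderInf_of_not_subexpGrowth hj⟩
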